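/- arXiv:1109.5473 — 4 statements merged into one kernel-verified Lean document; each statement's English description precedes it below -/
import Mathlib

section
/- Let D be a real symmetric idempotent N_b × N_b matrix and let M be a real symmetric N_b × N_b matrix. Then ‖[D,[D,M]]‖ = ‖[D,M]‖, where ‖·‖ is the Frobenius norm. -/
open Matrix

/-- The Frobenius norm `√(Tr(AᵀA))`. -/
noncomputable def frob {n : ℕ} (A : Matrix (Fin n) (Fin n) ℝ) : ℝ :=
  Real.sqrt (Matrix.trace (Aᵀ * A))

/-- The commutator `[A,B] = AB − BA`. -/
def mbr {n : ℕ} (A B : Matrix (Fin n) (Fin n) ℝ) : Matrix (Fin n) (Fin n) ℝ :=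
  A * B - B * A

/-- Taking the commutator of an idempotent `D` with `[D,M]` amounts to multiplying `[D,M]`
by the reflection `2D − 1`. -/
lemma mbr_mbr_of_idempotent {n : ℕ} {D : Matrix (Fin n) (Fin n) ℝ} (hD : D * D = D)
    (M : Matrix (Fin n) (Fin n) ℝ) :
    mbr D (mbr D M) = (D + D - 1) * mbr D M := by
  have h : M * D * D = M * D := by rw [mul_assoc, hD]
  simp only [mbr, mul_sub, sub_mul, add_mul, one_mul, ← mul_assoc, hD, h]
  abel

/-- The Frobenius norm is invariant under left multiplication by an orthogonal matrix. -/
lemma frob_mul_of_transpose_mul_self {n : ℕ} {Q : Matrix (Fin n) (Fin n) ℝ} (hQ : Qᵀ * Q = 1)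
    (A : Matrix (Fin n) (Fin n) ℝ) : frob (Q * A) = frob A := by
  rw [frob, frob, transpose_mul, mul_assoc, ← mul_assoc Qᵀ, hQ, one_mul]

/-- For a real symmetric idempotent `D` and a real symmetric `M`,
`‖[D,[D,M]]‖ = ‖[D,M]‖` in the Frobenius norm. -/
theorem frob_double_commutator_eq {Nb : ℕ} (hNb : 0 < Nb)
    (D M : Matrix (Fin Nb) (Fin Nb) ℝ)
    (hDsymm : Dᵀ = D) (hDidem : D * D = D) (hMsymm : Mᵀ = M) :
    frob (mbr D (mbr D M)) = frob (mbr D M) := by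
  rw [mbr_mbr_of_idempotent hDidem]
  apply frob_mul_of_transpose_mul_self
  simp only [transpose_sub, transpose_add, transpose_one, hDsymm, mul_sub, sub_mul, mul_add,
    add_mul, one_mul, mul_one, hDidem]
  abel
end

section
/- Let θ ∈ (0, 1/2), ν > 0 and k₀ ∈ ℕ, and let (e_k)_{k≥1} be a nonincreasing sequence of nonnegative real numbers satisfying e_{k+1} ≤ e_k − ν·e_k^{(1−θ)/θ} for all k ≥ k₀. Then there exists c > 0 such that e_k ≤ c·k^{−θ/(1−2θ)} for all k ≥ 1. -/
/-- One step of the recursion raises the power `-q` by at least `q * ν`. -/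
lemma rpow_neg_add_le_of_le_sub {q ν x y : ℝ} (hq : 0 < q) (hx : 0 < x) (hy : 0 < y)
    (h : y ≤ x - ν * x ^ (1 + q)) : x ^ (-q) + q * ν ≤ y ^ (-q) := by
  have hy_le : y ≤ x * Real.exp (-(ν * x ^ q)) := by
    rw [Real.rpow_add hx, Real.rpow_one] at h
    calc y ≤ x * (1 - ν * x ^ q) := by linarith
      _ ≤ x * Real.exp (-(ν * x ^ q)) := by
        gcongr
        exact Real.one_sub_le_exp_neg _
  calc x ^ (-q) + q * ν = x ^ (-q) * (q * (ν * x ^ q) + 1) := by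
        rw [Real.rpow_neg hx.le]
        have := (Real.rpow_pos_of_pos hx q).ne'
        field_simp
        ring
    _ ≤ x ^ (-q) * Real.exp (q * (ν * x ^ q)) := by
        gcongr
        exact Real.add_one_le_exp _
    _ = (x * Real.exp (-(ν * x ^ q))) ^ (-q) := by
        rw [Real.mul_rpow hx.le (Real.exp_pos _).le, ← Real.exp_mul]
        congr 2
        ring
    _ ≤ y ^ (-q) := Real.rpow_le_rpow_of_nonpos hy hy_le (by linarith)

/-- Along the recursion, the power `-q` grows at least linearly while the sequence is positive. -/
lemma mul_le_rpow_neg_of_recursion {q ν : ℝ} (hq : 0 < q) {k₀ : ℕ} {e : ℕ → ℝ}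
    (hantitone : Antitone e)
    (hrec : ∀ k, k₀ ≤ k → e (k + 1) ≤ e k - ν * e k ^ (1 + q)) (m : ℕ)
    (hpos : 0 < e (k₀ + m)) : q * ν * m ≤ e (k₀ + m) ^ (-q) := by
  induction m with
  | zero => simpa using (Real.rpow_pos_of_pos hpos (-q)).le
  | succ m ih =>
    have hm : 0 < e (k₀ + m) := hpos.trans_le (hantitone (by omega))
    have hstep := rpow_neg_add_le_of_le_sub hq hm hpos (hrec (k₀ + m) (by omega))
    push_cast
    linarith [ih hm]

/-- abstract recursion argument for the degenerate Łojasiewicz case.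
A nonincreasing nonnegative sequence with `e_{k+1} ≤ e_k − ν·e_k^{(1−θ)/θ}` for
`k ≥ k₀` decays like `k^{−θ/(1−2θ)}`. -/
theorem recursion_sublinear_decay (θ ν : ℝ) (hθ : θ ∈ Set.Ioo (0 : ℝ) (1 / 2))
    (hν : 0 < ν) (k₀ : ℕ) (e : ℕ → ℝ)
    (hnonneg : ∀ k, 0 ≤ e k) (hantitone : Antitone e)
    (hrec : ∀ k, k₀ ≤ k → e (k + 1) ≤ e k - ν * e k ^ ((1 - θ) / θ)) :
    ∃ c > (0 : ℝ), ∀ k : ℕ, 1 ≤ k → e k ≤ c * (k : ℝ) ^ (-(θ / (1 - 2 * θ))) := by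
  obtain ⟨hθ0, hθ1⟩ := hθ
  have hd : 0 < 1 - 2 * θ := by linarith
  set p := θ / (1 - 2 * θ) with hp_def
  have hp : 0 < p := div_pos hθ0 hd
  have hexp : (1 - θ) / θ = 1 + p⁻¹ := by
    rw [hp_def]
    field_simp
    ring
  rw [hexp] at hrec
  have hq : 0 < p⁻¹ := inv_pos.mpr hp
  have hK : (0 : ℝ) < k₀ + 1 := by positivity
  set a := p⁻¹ * ν / (k₀ + 1) with ha_def
  have ha : 0 < a := by positivity
  have hA : 0 < a ^ (-p) := Real.rpow_pos_of_pos ha _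
  have hB : 0 ≤ e 0 * (k₀ + 1 : ℝ) ^ p := mul_nonneg (hnonneg 0) (by positivity)
  refine ⟨a ^ (-p) + e 0 * (k₀ + 1 : ℝ) ^ p, by positivity, fun k hk => ?_⟩
  have hk0 : (0 : ℝ) < k := by exact_mod_cast hk
  have hkp : 0 < (k : ℝ) ^ (-p) := Real.rpow_pos_of_pos hk0 _
  rw [add_mul]
  rcases le_or_gt k k₀ with hle | hlt
  · have hone : 1 ≤ (k₀ + 1 : ℝ) ^ p * (k : ℝ) ^ (-p) := by
      rw [Real.rpow_neg hk0.le, ← div_eq_mul_inv, one_le_div (by positivity)]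
      gcongr
      exact_mod_cast hle.trans (Nat.le_succ _)
    have h0 : e k ≤ e 0 := hantitone (Nat.zero_le k)
    have := le_mul_of_one_le_right (hnonneg 0) hone
    have := mul_pos hA hkp
    linarith
  · suffices h : e k ≤ a ^ (-p) * (k : ℝ) ^ (-p) from
      h.trans (le_add_of_nonneg_right (mul_nonneg hB hkp.le))
    rcases (hnonneg k).eq_or_lt with hzero | hpos
    · rw [← hzero]
      positivity
    obtain ⟨m, rfl⟩ := Nat.exists_eq_add_of_le hlt.le
    have hm : (1 : ℝ) ≤ m := by exact_mod_cast (by omega : 1 ≤ m)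
    have hlin : a * (k₀ + m : ℕ) ≤ e (k₀ + m) ^ (-p⁻¹) := by
      refine le_trans ?_ (mul_le_rpow_neg_of_recursion hq hantitone hrec m hpos)
      rw [ha_def, div_mul_eq_mul_div, div_le_iff₀ hK, mul_assoc (p⁻¹ * ν)]
      gcongr
      push_cast
      nlinarith [(Nat.cast_nonneg k₀ : (0 : ℝ) ≤ k₀)]
    rw [← Real.mul_rpow ha.le hk0.le]
    calc e (k₀ + m) = (e (k₀ + m) ^ (-p⁻¹)) ^ (-p) := by
          rw [← Real.rpow_mul hpos.le, neg_mul_neg, inv_mul_cancel₀ hp.ne', Real.rpow_one]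
      _ ≤ (a * (k₀ + m : ℕ)) ^ (-p) :=
          Real.rpow_le_rpow_of_nonpos (mul_pos ha hk0) hlin (by linarith)
end

section
/- Let (D_k) be a sequence in a finite-dimensional real normed vector space, let (E_k) and (g_k) be sequences of nonnegative real numbers, and let β > 0, M > 0, κ > 0, θ ∈ (0,1] and k₀ ∈ ℕ. Assume: (i) (E_k) is nonincreasing with limit 0; (ii) E_k − E_{k+1} ≥ β·g_k² for all k; (iii) ‖D_{k+1} − D_k‖ ≤ M·g_k for all k; (iv) E_k^{1−θ} ≤ κ·g_k for all k ≥ k₀. Then Σ_k ‖D_{k+1} − D_k‖ < ∞; in particular the sequence (D_k) converges. -/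
open Filter Topology

/-- Tangent-line bound coming from the concavity of `x ↦ x ^ θ`. -/
theorem mul_sub_div_rpow_le_rpow_sub_rpow {x y θ : ℝ} (hx : 0 < x) (hy : 0 ≤ y)
    (hθ₀ : 0 ≤ θ) (hθ₁ : θ ≤ 1) :
    θ * ((x - y) / x ^ (1 - θ)) ≤ x ^ θ - y ^ θ := by
  have hxθ : 0 < x ^ θ := Real.rpow_pos_of_pos hx θ
  have hB := rpow_one_add_le_one_add_mul_self (s := y / x - 1)
    (by linarith [div_nonneg hy hx.le]) hθ₀ hθ₁
  rw [add_sub_cancel, Real.div_rpow hy hx.le, div_le_iff₀ hxθ] at hB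
  have hquot : (x - y) / x ^ (1 - θ) = (1 - y / x) * x ^ θ := by
    rw [Real.rpow_sub hx, Real.rpow_one]
    field_simp
  rw [hquot]
  linarith

/-- Sufficient decrease together with a Łojasiewicz inequality at a single step bounds the
step size by the decrease of the `θ`-th power of the energy. -/
theorem mul_le_rpow_sub_rpow_of_lojasiewicz {x y g β κ θ : ℝ} (hy : 0 ≤ y) (hg : 0 ≤ g)
    (hβ : 0 < β) (hκ : 0 < κ) (hθ₀ : 0 ≤ θ) (hθ₁ : θ ≤ 1)
    (hdecr : β * g ^ 2 ≤ x - y) (hloja : x ^ (1 - θ) ≤ κ * g) :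
    θ * β / κ * g ≤ x ^ θ - y ^ θ := by
  have hyx : y ≤ x := by nlinarith [mul_nonneg hβ.le (sq_nonneg g)]
  rcases hg.eq_or_lt with rfl | hg
  · simpa using Real.rpow_le_rpow hy hyx hθ₀
  have hx : 0 < x := by nlinarith [mul_pos hβ (pow_pos hg 2)]
  have ha : 0 < x ^ (1 - θ) := Real.rpow_pos_of_pos hx _
  refine le_trans ?_ (mul_sub_div_rpow_le_rpow_sub_rpow hx hy hθ₀ hθ₁)
  rw [show θ * β / κ * g = θ * (β * g / κ) by ring]
  refine mul_le_mul_of_nonneg_left ?_ hθ₀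
  rw [div_le_div_iff₀ hκ ha]
  calc β * g * x ^ (1 - θ) ≤ β * g * (κ * g) := by gcongr
    _ = β * g ^ 2 * κ := by ring
    _ ≤ (x - y) * κ := by gcongr

/-- the abstract Łojasiewicz-type convergence mechanism. -/
theorem abstract_lojasiewicz_convergence {V : Type*} [NormedAddCommGroup V]
    [NormedSpace ℝ V] [FiniteDimensional ℝ V]
    (D : ℕ → V) (E g : ℕ → ℝ) (β M κ θ : ℝ) (k₀ : ℕ)
    (hβ : 0 < β) (hM : 0 < M) (hκ : 0 < κ) (hθ : θ ∈ Set.Ioc (0 : ℝ) 1)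
    (hEnonneg : ∀ k, 0 ≤ E k) (hgnonneg : ∀ k, 0 ≤ g k)
    (hEantitone : Antitone E) (hEtendsto : Tendsto E atTop (𝓝 0))
    (hdecr : ∀ k, β * g k ^ 2 ≤ E k - E (k + 1))
    (hstep : ∀ k, ‖D (k + 1) - D k‖ ≤ M * g k)
    (hloja : ∀ k, k₀ ≤ k → E k ^ (1 - θ) ≤ κ * g k) :
    Summable (fun k => ‖D (k + 1) - D k‖) ∧ ∃ L, Tendsto D atTop (𝓝 L) := by
  obtain ⟨hθ₀, hθ₁⟩ := hθ
  have hc : 0 < θ * β / κ := by positivity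
  have hkey (k : ℕ) : θ * β / κ * g (k + k₀) ≤ E (k + k₀) ^ θ - E (k + 1 + k₀) ^ θ := by
    rw [add_right_comm k 1 k₀]
    exact mul_le_rpow_sub_rpow_of_lojasiewicz (hEnonneg _) (hgnonneg _) hβ hκ hθ₀.le hθ₁
      (hdecr _) (hloja _ (Nat.le_add_left _ _))
  have hsum_shift : Summable fun k => θ * β / κ * g (k + k₀) := by
    refine summable_of_sum_range_le (c := E (0 + k₀) ^ θ)
      (fun k => mul_nonneg hc.le (hgnonneg _)) fun n => ?_
    calc ∑ k ∈ Finset.range n, θ * β / κ * g (k + k₀)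
        ≤ ∑ k ∈ Finset.range n, (E (k + k₀) ^ θ - E (k + 1 + k₀) ^ θ) :=
          Finset.sum_le_sum fun k _ => hkey k
      _ = E (0 + k₀) ^ θ - E (n + k₀) ^ θ :=
          Finset.sum_range_sub' (fun k => E (k + k₀) ^ θ) n
      _ ≤ E (0 + k₀) ^ θ := sub_le_self _ (Real.rpow_nonneg (hEnonneg _) θ)
  have hg : Summable g :=
    (summable_nat_add_iff k₀).mp ((summable_mul_left_iff hc.ne').mp hsum_shift)
  have hD : Summable fun k => ‖D (k + 1) - D k‖ :=
    Summable.of_nonneg_of_le (fun _ => norm_nonneg _) hstep (hg.mul_left M)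
  have : CompleteSpace V := FiniteDimensional.complete ℝ V
  refine ⟨hD, cauchySeq_tendsto_of_complete (cauchySeq_of_summable_dist ?_)⟩
  simpa only [dist_eq_norm', Nat.succ_eq_add_one] using hD
end

section
/- Let F be a real symmetric N_b × N_b matrix with eigenvalues λ₁ ≤ … ≤ λ_{N_b} counted with multiplicity, and suppose λ_{N+1} − λ_N ≥ γ for some γ > 0. Let D* ∈ 𝒫 be the orthogonal projector onto the span of eigenvectors of F associated with λ₁, …, λ_N. Then for every D ∈ 𝒫: Tr(FD) ≥ Tr(FD*) + (γ/2)·‖D − D*‖². -/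
open Matrix

/-- The manifold `𝒫` of real symmetric idempotent matrices of trace `N`. -/
noncomputable def HFP (Nb N : ℕ) : Set (Matrix (Fin Nb) (Fin Nb) ℝ) :=
  {D | Dᵀ = D ∧ D * D = D ∧ Matrix.trace D = (N : ℝ)}

section OrthonormalFamily

variable {ι : Type*} [Fintype ι]

theorem Matrix.trace_mul_vecMulVec_self (M : Matrix ι ι ℝ) (u : ι → ℝ) :
    trace (M * vecMulVec u u) = u ⬝ᵥ (M *ᵥ u) := by
  rw [mul_vecMulVec, trace_vecMulVec, dotProduct_comm]

/-- The rank-one projectors onto an orthonormal basis sum to the identity. -/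
theorem Matrix.sum_vecMulVec_self_eq_one [DecidableEq ι] (v : ι → ι → ℝ)
    (horth : ∀ i j, v i ⬝ᵥ v j = if i = j then (1 : ℝ) else 0) :
    ∑ i, vecMulVec (v i) (v i) = 1 := by
  have h : of v * (of v)ᵀ = 1 := by
    ext i j
    rw [mul_apply, one_apply, ← horth i j]
    rfl
  rw [← mul_eq_one_comm.mp h]
  ext a b
  simp [Matrix.sum_apply, mul_apply, vecMulVec_apply]

theorem Matrix.trace_eq_sum_dotProduct_mulVec [DecidableEq ι] (v : ι → ι → ℝ)
    (horth : ∀ i j, v i ⬝ᵥ v j = if i = j then (1 : ℝ) else 0) (M : Matrix ι ι ℝ) :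
    trace M = ∑ i, v i ⬝ᵥ (M *ᵥ v i) := by
  conv_lhs => rw [← Matrix.mul_one M, ← sum_vecMulVec_self_eq_one v horth]
  simp only [Matrix.mul_sum, trace_sum, trace_mul_vecMulVec_self]

theorem Matrix.sum_vecMulVec_self_mulVec [DecidableEq ι] (v : ι → ι → ℝ)
    (horth : ∀ i j, v i ⬝ᵥ v j = if i = j then (1 : ℝ) else 0) (s : Finset ι)
    {i : ι} (hi : i ∈ s) :
    (∑ j ∈ s, vecMulVec (v j) (v j)) *ᵥ v i = v i := by
  simp [Matrix.sum_mulVec, vecMulVec_mulVec, horth, hi]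

theorem Matrix.dotProduct_mulVec_self_of_symm_idem {D : Matrix ι ι ℝ}
    (hsymm : Dᵀ = D) (hidem : D * D = D) (u : ι → ℝ) :
    (D *ᵥ u) ⬝ᵥ (D *ᵥ u) = u ⬝ᵥ (D *ᵥ u) := by
  rw [dotProduct_mulVec, ← mulVec_transpose, hsymm, mulVec_mulVec, hidem, dotProduct_comm]

theorem Matrix.dotProduct_mulVec_nonneg_of_symm_idem {D : Matrix ι ι ℝ}
    (hsymm : Dᵀ = D) (hidem : D * D = D) (u : ι → ℝ) : 0 ≤ u ⬝ᵥ (D *ᵥ u) := by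
  rw [← dotProduct_mulVec_self_of_symm_idem hsymm hidem]
  exact Finset.sum_nonneg fun i _ => mul_self_nonneg _

theorem Matrix.dotProduct_mulVec_le_of_symm_idem {D : Matrix ι ι ℝ}
    (hsymm : Dᵀ = D) (hidem : D * D = D) (u : ι → ℝ) : u ⬝ᵥ (D *ᵥ u) ≤ u ⬝ᵥ u := by
  have h : 0 ≤ (u - D *ᵥ u) ⬝ᵥ (u - D *ᵥ u) :=
    Finset.sum_nonneg fun i _ => mul_self_nonneg _
  rw [sub_dotProduct, dotProduct_sub, dotProduct_sub,
    dotProduct_mulVec_self_of_symm_idem hsymm hidem, dotProduct_comm (D *ᵥ u) u] at h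
  linarith

end OrthonormalFamily

theorem frob_sq {n : ℕ} (A : Matrix (Fin n) (Fin n) ℝ) : frob A ^ 2 = trace (Aᵀ * A) := by
  refine Real.sq_sqrt ?_
  simp only [trace, diag_apply, mul_apply, transpose_apply]
  exact Finset.sum_nonneg fun i _ => Finset.sum_nonneg fun j _ => mul_self_nonneg _

/-- if the real symmetric matrix `F` has a gap `λ_{N+1} − λ_N ≥ γ` in its
(nondecreasingly ordered) eigenvalues, and `D*` is the orthogonal projector onto the span
of the eigenvectors associated with the first `N` eigenvalues, then for every `D ∈ 𝒫`,
`Tr(FD) ≥ Tr(FD*) + (γ/2)·‖D − D*‖²`.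
(Eigenvalues are `0`-indexed here, so `λ_N` is `lam ⟨N-1,_⟩` and `λ_{N+1}` is `lam ⟨N,_⟩`.) -/
theorem aufbau_quantitative_minimality {Nb N : ℕ} (hN : 0 < N) (hNNb : N < Nb)
    (F : Matrix (Fin Nb) (Fin Nb) ℝ) (hF : Fᵀ = F)
    (γ : ℝ) (hγ : 0 < γ)
    (lam : Fin Nb → ℝ) (v : Fin Nb → Fin Nb → ℝ)
    (hmono : Monotone lam)
    (horth : ∀ i j, v i ⬝ᵥ v j = if i = j then (1 : ℝ) else 0)
    (heig : ∀ i, F *ᵥ v i = lam i • v i)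
    (hgap : γ ≤ lam ⟨N, hNNb⟩ - lam ⟨N - 1, by omega⟩)
    (Dstar : Matrix (Fin Nb) (Fin Nb) ℝ)
    (hDstar : Dstar = ∑ i ∈ Finset.univ.filter (fun i : Fin Nb => (i : ℕ) < N),
      vecMulVec (v i) (v i)) :
    ∀ D ∈ HFP Nb N,
      Matrix.trace (F * Dstar) + γ / 2 * frob (D - Dstar) ^ 2 ≤ Matrix.trace (F * D) := by
  intro D ⟨hDs, hDi, hDt⟩
  set s := Finset.univ.filter (fun i : Fin Nb => (i : ℕ) < N) with hs
  set d : Fin Nb → ℝ := fun i => v i ⬝ᵥ (D *ᵥ v i) with hd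
  have hd0 : ∀ i, 0 ≤ d i := fun i => dotProduct_mulVec_nonneg_of_symm_idem hDs hDi _
  have hd1 : ∀ i, d i ≤ 1 := fun i => by
    simpa [horth] using dotProduct_mulVec_le_of_symm_idem hDs hDi (v i)
  have hcard : ∑ i ∈ s, (1 : ℝ) = N := by
    rw [Finset.sum_const, nsmul_one, hs, Fin.card_filter_val_lt, min_eq_right hNNb.le]
  have hmul (M : Matrix (Fin Nb) (Fin Nb) ℝ) :
      trace (M * Dstar) = ∑ i ∈ s, v i ⬝ᵥ (M *ᵥ v i) := by
    simp only [hDstar, Matrix.mul_sum, trace_sum, trace_mul_vecMulVec_self]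
  have hsymm : Dstarᵀ = Dstar := by
    simp [hDstar, transpose_sum, transpose_vecMulVec]
  have hstar : trace (Dstar * Dstar) = N := by
    rw [hmul, ← hcard]
    refine Finset.sum_congr rfl fun i hi => ?_
    rw [hDstar, sum_vecMulVec_self_mulVec v horth s hi]
    simp [horth]
  have hFstar : trace (F * Dstar) = ∑ i ∈ s, lam i := by
    simp [hmul, heig, horth]
  have hFD : trace (F * D) = ∑ i, lam i * d i := by
    rw [trace_mul_comm, trace_eq_sum_dotProduct_mulVec v horth]
    simp [← mulVec_mulVec, heig, mulVec_smul, hd]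
  have hsum : ∑ i, d i = N := by
    rw [← hDt, trace_eq_sum_dotProduct_mulVec v horth]
  have hfrob : frob (D - Dstar) ^ 2 = 2 * ∑ i ∈ s, (1 - d i) := by
    rw [frob_sq, transpose_sub, hDs, hsymm, Matrix.sub_mul, Matrix.mul_sub, Matrix.mul_sub,
      trace_sub, trace_sub, trace_sub, hDi, hDt, hstar, trace_mul_comm Dstar D, hmul,
      Finset.sum_sub_distrib, hcard]
    ring
  set b := lam ⟨N, hNNb⟩
  have hpt : ∀ i, b * (d i - if i ∈ s then 1 else 0) + γ * (if i ∈ s then 1 - d i else 0) ≤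
      lam i * d i - if i ∈ s then lam i else 0 := by
    intro i
    by_cases hi : i ∈ s
    · have hlt : (i : ℕ) < N := by simpa [hs] using hi
      have hle : lam i ≤ lam ⟨N - 1, by omega⟩ := hmono (Fin.le_def.mpr (Nat.le_sub_one_of_lt hlt))
      simp only [hi, if_true]
      nlinarith [hd1 i]
    · have hge : N ≤ (i : ℕ) := by simpa [hs] using hi
      have hle : b ≤ lam i := hmono (Fin.le_def.mpr hge)
      simp only [hi, if_false]
      nlinarith [hd0 i]
  have htot := Finset.sum_le_sum fun i (_ : i ∈ Finset.univ) => hpt i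
  simp only [Finset.sum_add_distrib, ← Finset.mul_sum, Finset.sum_sub_distrib,
    Finset.sum_ite_mem, Finset.univ_inter, hsum, hcard] at htot
  rw [hFstar, hFD, hfrob, Finset.sum_sub_distrib, hcard]
  linarith
end
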